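/- Fix δ₀ ∈ (0,1) and δ₀ < |E| < 2 − δ₀. There are constants c₁ > 0, C > 0 and λ₀ > 0, independent of λ, such that for 0 < λ < λ₀, N ≥ 1 and η₁ = e^{−λ² N / 500}, and for all unit vectors u, w ∈ ℝ²: mes[ ε ∈ {1,−1}^N : |⟨M_N(E;ε) u, w⟩| < η₁ ‖M_N(E;ε)‖ ] ≤ C η₁^{c₁/2}. -/

import Mathlib

noncomputable section

/-- Operator norm of a `2 × 2` real matrix acting on Euclidean `ℝ²`. -/
def opNorm (g : Matrix (Fin 2) (Fin 2) ℝ) : ℝ :=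
  ‖Matrix.toEuclideanCLM (𝕜 := ℝ) g‖

/-- Euclidean inner product on `ℝ²`. -/
def dot2 (u v : Fin 2 → ℝ) : ℝ := u 0 * v 0 + u 1 * v 1

/-- Euclidean norm on `ℝ²`. -/
def norm2 (u : Fin 2 → ℝ) : ℝ := Real.sqrt (u 0 ^ 2 + u 1 ^ 2)

/-- Single-step Anderson–Bernoulli matrix `g_E(ε) = [[E - λε, -1],[1,0]]`. -/
def gE (lam E x : ℝ) : Matrix (Fin 2) (Fin 2) ℝ := !![E - lam * x, -1; 1, 0]

/-- Transfer matrix `M_N(E;ε) = g_E(ε_N) ⋯ g_E(ε_1)`. -/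
def transfer (lam E : ℝ) (N : ℕ) (eps : Fin N → ℝ) : Matrix (Fin 2) (Fin 2) ℝ :=
  ((List.ofFn fun j => gE lam E (eps j)).reverse).prod

/-- `±1`-value of a Boolean (`true ↔ 1`, `false ↔ -1`). -/
def bval (b : Bool) : ℝ := if b then 1 else -1

/-- Transfer matrix with Bernoulli `±1` entries, cube encoded as `Fin N → Bool`. -/
def transferB (lam E : ℝ) (N : ℕ) (σ : Fin N → Bool) : Matrix (Fin 2) (Fin 2) ℝ :=
  transfer lam E N fun j => bval (σ j)

/-- Uniform measure of a subset of the Boolean cube `{1,-1}^N`. -/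
def mes {n : ℕ} (S : Set (Fin n → Bool)) : ℝ := by
  classical exact ((Finset.univ.filter fun ε => ε ∈ S).card : ℝ) / 2 ^ n

/-- The linear coordinate on `ℝ²` in which the free transfer matrix `[[2 Re ζ, -1],[1,0]]` acts as
multiplication by the unit complex number `ζ`. -/
def ellipticCoord (ζ : ℂ) (u : Fin 2 → ℝ) : ℂ := u 0 - (starRingEnd ℂ) ζ * u 1

/-- The shear `x + iy ↦ (x - m y) + iy`. -/
def shear (m : ℝ) (z : ℂ) : ℂ := z - m * z.im

/-- Squared Euclidean norm on `ℝ²`. -/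
def normSq2 (u : Fin 2 → ℝ) : ℝ := u 0 ^ 2 + u 1 ^ 2

lemma sq_norm_eq (z : ℂ) : ‖z‖ ^ 2 = z.re ^ 2 + z.im ^ 2 := by
  rw [← Complex.normSq_eq_norm_sq, Complex.normSq_apply]; ring

lemma ellipticCoord_gE {ζ : ℂ} (hζ : ‖ζ‖ = 1) (hS : ζ.im ≠ 0) (lam x : ℝ) (u : Fin 2 → ℝ) :
    ellipticCoord ζ ((gE lam (2 * ζ.re) x).mulVec u) =
      shear (lam * x / ζ.im) (ζ * ellipticCoord ζ u) := by
  have h1 : ζ.re ^ 2 + ζ.im ^ 2 = 1 := by rw [← sq_norm_eq, hζ]; norm_num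
  apply Complex.ext
  · simp [ellipticCoord, shear, gE, Matrix.mulVec, dotProduct, Fin.sum_univ_two]
    field_simp
    linear_combination u 1 * h1
  · simp [ellipticCoord, shear, gE, Matrix.mulVec, dotProduct, Fin.sum_univ_two]
    ring

lemma sq_norm_ellipticCoord {ζ : ℂ} (hζ : ‖ζ‖ = 1) (u : Fin 2 → ℝ) :
    ‖ellipticCoord ζ u‖ ^ 2 = u 0 ^ 2 - 2 * ζ.re * u 0 * u 1 + u 1 ^ 2 := by
  have h1 : ζ.re ^ 2 + ζ.im ^ 2 = 1 := by rw [← sq_norm_eq, hζ]; norm_num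
  rw [sq_norm_eq]
  simp [ellipticCoord]
  linear_combination u 1 ^ 2 * h1

lemma sq_norm_shear (m : ℝ) (z : ℂ) :
    ‖shear m z‖ ^ 2 = ‖z‖ ^ 2 - 2 * m * z.re * z.im + m ^ 2 * z.im ^ 2 := by
  simp [sq_norm_eq, shear]; ring

lemma shear_smul (m r : ℝ) (z : ℂ) : shear m (r * z) = r * shear m z := by
  simp [shear]; ring

/-- A trigonometric polynomial solving the cohomological equation for the rotation by `ζ`. -/
lemma exists_corrector {ζ : ℂ} (h2 : ζ ^ 2 ≠ 1) (h4 : ζ ^ 4 ≠ 1) (S : ℝ) :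
    ∃ (ψ : ℂ → ℝ) (K : ℝ), 0 < K ∧ (∀ z, ‖z‖ = 1 → |ψ z| ≤ K) ∧
      (∀ z w, ‖z‖ = 1 → ‖w‖ = 1 → |ψ z - ψ w| ≤ K * ‖z - w‖) ∧
      ∀ z, ψ (ζ * z) - ψ z =
        (((ζ * z) ^ 2).re / 2 - ((ζ * z) ^ 4).re / 4) / S ^ 2 := by
  have h2' : ζ ^ 2 - 1 ≠ 0 := sub_ne_zero.2 h2
  have h4' : ζ ^ 4 - 1 ≠ 0 := sub_ne_zero.2 h4
  set α : ℂ := ζ ^ 2 / (ζ ^ 2 - 1) * ((1 / (2 * S ^ 2) : ℝ) : ℂ) with hα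
  set β : ℂ := -(ζ ^ 4 / (ζ ^ 4 - 1)) * ((1 / (4 * S ^ 2) : ℝ) : ℂ) with hβ
  refine ⟨fun z => (α * z ^ 2 + β * z ^ 4).re, 2 * ‖α‖ + 4 * ‖β‖ + 1, by positivity, ?_, ?_, ?_⟩
  · intro z hz
    refine (Complex.abs_re_le_norm _).trans ((norm_add_le _ _).trans ?_)
    simp only [norm_mul, norm_pow, hz]
    linarith [norm_nonneg α, norm_nonneg β]
  · intro z w hz hw
    rw [← Complex.sub_re]
    refine (Complex.abs_re_le_norm _).trans ?_
    have e : α * z ^ 2 + β * z ^ 4 - (α * w ^ 2 + β * w ^ 4) =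
        (α * (z + w) + β * ((z + w) * (z ^ 2 + w ^ 2))) * (z - w) := by ring
    rw [e, norm_mul]
    refine mul_le_mul_of_nonneg_right ?_ (norm_nonneg _)
    have a1 : ‖z + w‖ ≤ 2 := (norm_add_le _ _).trans (by linarith)
    have a2 : ‖z ^ 2 + w ^ 2‖ ≤ 2 := (norm_add_le _ _).trans (by simp [hz, hw]; norm_num)
    have a3 : ‖z + w‖ * ‖z ^ 2 + w ^ 2‖ ≤ 2 * 2 :=
      mul_le_mul a1 a2 (norm_nonneg _) (by norm_num)
    refine (norm_add_le _ _).trans ?_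
    simp only [norm_mul]
    nlinarith [norm_nonneg α, norm_nonneg β]
  · intro z
    have e : α * (ζ * z) ^ 2 + β * (ζ * z) ^ 4 - (α * z ^ 2 + β * z ^ 4) =
        ((1 / (2 * S ^ 2) : ℝ) : ℂ) * (ζ * z) ^ 2 - ((1 / (4 * S ^ 2) : ℝ) : ℂ) * (ζ * z) ^ 4 := by
      rw [hα, hβ]
      field_simp
      ring
    simp only [← Complex.sub_re]
    rw [e, Complex.sub_re, Complex.re_ofReal_mul, Complex.re_ofReal_mul]
    rcases eq_or_ne S 0 with rfl | hS
    · simp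
    · field_simp

lemma abs_log_one_add_sub_le {y : ℝ} (hy : |y| ≤ 1 / 2) : |Real.log (1 + y) - y| ≤ 2 * y ^ 2 := by
  obtain ⟨h1, h2⟩ := abs_le.1 hy
  have hp : 0 < 1 + y := by linarith
  have hu := Real.log_le_sub_one_of_pos hp
  have hl := Real.one_sub_inv_le_log_of_pos hp
  have : 1 - (1 + y)⁻¹ - y + 2 * y ^ 2 ≥ 0 := by
    have : 1 - (1 + y)⁻¹ - y + 2 * y ^ 2 = y ^ 2 * (1 + 2 * y) / (1 + y) := by
      field_simp; ring
    rw [this]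
    have : 0 ≤ 1 + 2 * y := by linarith
    positivity
  rw [abs_le]; constructor <;> nlinarith [sq_nonneg y]

lemma norm_normalize_sub_le {z w : ℂ} (hz : ‖z‖ = 1) (hw : w ≠ 0) :
    ‖w / ‖w‖ - z‖ ≤ 2 * ‖w - z‖ := by
  have hw' : (‖w‖ : ℂ) ≠ 0 := by simpa using hw
  have h : ‖w / ‖w‖ - w‖ ≤ ‖w - z‖ := by
    have e : w / ‖w‖ - w = (w / ‖w‖) * ((1 - ‖w‖ : ℝ) : ℂ) := by
      push_cast; field_simp
    rw [e, norm_mul, norm_div, Complex.norm_real, Complex.norm_real, norm_norm,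
      div_self (by simpa using hw), one_mul, ← hz, norm_sub_rev w z]
    exact abs_norm_sub_norm_le z w
  calc ‖w / ‖w‖ - z‖ = ‖(w / ‖w‖ - w) + (w - z)‖ := by congr 1; ring
    _ ≤ _ := (norm_add_le _ _).trans (by linarith)

/-- Logarithm of the squared norm, corrected by `ψ` evaluated at the direction. -/
def correctedLog (ψ : ℂ → ℝ) (lam : ℝ) (z : ℂ) : ℝ :=
  Real.log (‖z‖ ^ 2) + lam ^ 2 * ψ (z / ‖z‖)

lemma sq_norm_shear_unit {e : ℂ} (he : ‖e‖ = 1) (m : ℝ) :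
    ‖shear m e‖ ^ 2 = 1 + (m ^ 2 * e.im ^ 2 - 2 * m * e.re * e.im) := by
  rw [sq_norm_shear, he]; ring

lemma abs_sq_norm_shear_sub_one_le {e : ℂ} (he : ‖e‖ = 1) {m : ℝ} (hm : |m| ≤ 1 / 8) :
    |m ^ 2 * e.im ^ 2 - 2 * m * e.re * e.im| ≤ 3 * |m| := by
  have h1 : e.re ^ 2 + e.im ^ 2 = 1 := by rw [← sq_norm_eq, he]; norm_num
  have h2 : |2 * e.re * e.im| ≤ 1 := abs_le.2 ⟨by nlinarith [sq_nonneg (e.re + e.im)],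
    by nlinarith [sq_nonneg (e.re - e.im)]⟩
  have h3 : |2 * m * e.re * e.im| ≤ |m| := by
    rw [show 2 * m * e.re * e.im = m * (2 * e.re * e.im) by ring, abs_mul]
    exact mul_le_of_le_one_right (abs_nonneg _) h2
  have h4 : |m ^ 2 * e.im ^ 2| ≤ |m| := by
    rw [abs_of_nonneg (by positivity), ← sq_abs m]
    nlinarith [abs_nonneg m, sq_nonneg e.re, sq_nonneg e.im, sq_nonneg |m|]
  refine (abs_sub _ _).trans ?_
  linarith [abs_nonneg m]

lemma shear_ne_zero {e : ℂ} (he : ‖e‖ = 1) {m : ℝ} (hm : |m| ≤ 1 / 8) : shear m e ≠ 0 := by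
  have h := (abs_le.1 (abs_sq_norm_shear_sub_one_le he hm)).1
  have h2 := sq_norm_shear_unit he m
  intro h0
  rw [h0] at h2
  norm_num at h2
  linarith

lemma abs_log_sq_norm_shear_le {e : ℂ} (he : ‖e‖ = 1) {m : ℝ} (hm : |m| ≤ 1 / 8) :
    |Real.log (‖shear m e‖ ^ 2)| ≤ 6 * |m| := by
  rw [sq_norm_shear_unit he]
  have h := abs_sq_norm_shear_sub_one_le he hm
  set y := m ^ 2 * e.im ^ 2 - 2 * m * e.re * e.im
  have h2 := abs_log_one_add_sub_le (y := y) (by linarith)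
  have h3 : |Real.log (1 + y)| ≤ |Real.log (1 + y) - y| + |y| := by
    simpa using abs_add_le (Real.log (1 + y) - y) y
  rw [← sq_abs y] at h2
  nlinarith [abs_nonneg y, abs_nonneg m]

lemma abs_log_sq_norm_shear_add_sub_le {e : ℂ} (he : ‖e‖ = 1) {m : ℝ} (hm : |m| ≤ 1 / 8) :
    |Real.log (‖shear m e‖ ^ 2) + Real.log (‖shear (-m) e‖ ^ 2) -
      m ^ 2 * (2 * e.im ^ 2 - 4 * e.re ^ 2 * e.im ^ 2)| ≤ 51 * m ^ 4 := by
  have h1 : e.re ^ 2 + e.im ^ 2 = 1 := by rw [← sq_norm_eq, he]; norm_num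
  have hn : |-m| ≤ 1 / 8 := by rwa [abs_neg]
  have p1 : ‖shear m e‖ ^ 2 ≠ 0 := by simpa using shear_ne_zero he hm
  have p2 : ‖shear (-m) e‖ ^ 2 ≠ 0 := by simpa using shear_ne_zero he hn
  rw [← Real.log_mul p1 p2, sq_norm_shear_unit he, sq_norm_shear_unit he]
  have hm2 : m ^ 2 ≤ 1 / 64 := by
    rw [← sq_abs]; nlinarith [abs_nonneg m]
  have hi : e.im ^ 2 ≤ 1 := by nlinarith [sq_nonneg e.re]
  set b := e.im ^ 2 with hb
  have hb0 : 0 ≤ b := sq_nonneg _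
  have hre : e.re ^ 2 = 1 - b := by linarith
  set y := 2 * m ^ 2 * b + m ^ 4 * b ^ 2 - 4 * m ^ 2 * ((1 - b) * b) with hy
  have e1 : (1 + (m ^ 2 * b - 2 * m * e.re * e.im)) *
      (1 + ((-m) ^ 2 * b - 2 * (-m) * e.re * e.im)) = 1 + y := by
    rw [hy, ← hre, hb]; ring
  have hbb : (1 - b) * b ≤ 1 / 4 := by nlinarith [sq_nonneg (b - 1 / 2)]
  have hbb0 : 0 ≤ (1 - b) * b := mul_nonneg (by linarith) hb0
  have hm0 := sq_nonneg m
  have hb2 : b ^ 2 ≤ 1 := by nlinarith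
  have hm4 : m ^ 4 * b ^ 2 ≤ m ^ 4 := mul_le_of_le_one_right (by positivity) hb2
  have hm4' : 0 ≤ m ^ 4 * b ^ 2 := by positivity
  have hm4'' : m ^ 4 ≤ m ^ 2 := by nlinarith
  have hyb : |y| ≤ 5 * m ^ 2 := abs_le.2 ⟨by nlinarith, by nlinarith⟩
  have hl := abs_log_one_add_sub_le (y := y) (by linarith)
  have hy2 : y ^ 2 ≤ 25 * m ^ 4 := by
    rw [← sq_abs]; nlinarith [abs_nonneg y]
  rw [e1, show m ^ 2 * (2 * b - 4 * e.re ^ 2 * b) = y - m ^ 4 * b ^ 2 by rw [hy, hre]; ring]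
  have : |Real.log (1 + y) - (y - m ^ 4 * b ^ 2)| ≤ |Real.log (1 + y) - y| + |m ^ 4 * b ^ 2| := by
    rw [show Real.log (1 + y) - (y - m ^ 4 * b ^ 2) = (Real.log (1 + y) - y) + m ^ 4 * b ^ 2 by ring]
    exact abs_add_le _ _
  rw [abs_of_nonneg hm4'] at this
  linarith

lemma correctedLog_shear_sub (ψ : ℂ → ℝ) (lam m : ℝ) (ζ : ℂ) {z : ℂ} (hz : z ≠ 0)
    (h : shear m (ζ * (z / ‖z‖)) ≠ 0) :
    correctedLog ψ lam (shear m (ζ * z)) - correctedLog ψ lam z =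
      Real.log (‖shear m (ζ * (z / ‖z‖))‖ ^ 2) +
        lam ^ 2 * (ψ (shear m (ζ * (z / ‖z‖)) / ‖shear m (ζ * (z / ‖z‖))‖) - ψ (z / ‖z‖)) := by
  have hz' : (‖z‖ : ℂ) ≠ 0 := by simpa using hz
  have hn : ‖z‖ ≠ 0 := by simpa using hz
  set v := shear m (ζ * (z / ‖z‖)) with hv
  have e : shear m (ζ * z) = ‖z‖ * v := by
    rw [hv, ← shear_smul]; congr 1; field_simp
  have hvn : ‖v‖ ≠ 0 := by simpa using h
  have hd : (‖z‖ : ℂ) * v / ((‖z‖ * ‖v‖ : ℝ) : ℂ) = v / ‖v‖ := by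
    push_cast; rw [mul_div_mul_left _ _ hz']
  unfold correctedLog
  rw [e, norm_mul, Complex.norm_real, norm_norm, hd, mul_pow,
    Real.log_mul (pow_ne_zero 2 hn) (pow_ne_zero 2 hvn)]
  ring

lemma exists_correctedLog_estimates {ζ : ℂ} (hζ : ‖ζ‖ = 1) (hS : 0 < ζ.im) (h2 : ζ ^ 2 ≠ 1)
    (h4 : ζ ^ 4 ≠ 1) :
    ∃ (ψ : ℂ → ℝ) (K lam1 : ℝ), 1 ≤ K ∧ 0 < lam1 ∧ lam1 ≤ 1 ∧ (∀ z, ‖z‖ = 1 → |ψ z| ≤ K) ∧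
      ∀ lam : ℝ, 0 < lam → lam < lam1 → ∀ z : ℂ, z ≠ 0 →
        |correctedLog ψ lam (shear (lam / ζ.im) (ζ * z)) - correctedLog ψ lam z| ≤ K * lam ∧
        |correctedLog ψ lam (shear (-(lam / ζ.im)) (ζ * z)) - correctedLog ψ lam z| ≤ K * lam ∧
        |(correctedLog ψ lam (shear (lam / ζ.im) (ζ * z)) - correctedLog ψ lam z) +
          (correctedLog ψ lam (shear (-(lam / ζ.im)) (ζ * z)) - correctedLog ψ lam z) -
            2 * (1 / (4 * ζ.im ^ 2)) * lam ^ 2| ≤ K * lam ^ 3 := by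
  set S := ζ.im with hSdef
  obtain ⟨ψ, K, hK, hb, hL, hc⟩ := exists_corrector h2 h4 S
  have c1 : 0 ≤ 6 / S := by positivity
  have c2 : 0 ≤ 51 / S ^ 4 := by positivity
  have c3 : 0 ≤ 4 * K / S := by positivity
  refine ⟨ψ, 1 + 6 / S + 2 * K + 51 / S ^ 4 + 4 * K / S, min 1 (S / 8), by linarith,
    by positivity, min_le_left _ _, fun z hz => (hb z hz).trans (by linarith), ?_⟩
  intro lam hlam hlam1 z hz
  have hlam1' : lam ≤ 1 := (hlam1.trans_le (min_le_left _ _)).le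
  have hlam2 : lam ≤ S / 8 := (hlam1.trans_le (min_le_right _ _)).le
  set m := lam / S with hm
  have hm0 : 0 < m := by positivity
  have hm8 : |m| ≤ 1 / 8 := by
    rw [abs_of_pos hm0, hm, div_le_iff₀ hS]; linarith
  have hm8' : |-m| ≤ 1 / 8 := by rwa [abs_neg]
  set e0 : ℂ := z / ‖z‖ with he0
  have he0n : ‖e0‖ = 1 := by
    rw [he0, norm_div, Complex.norm_real, norm_norm, div_self (by simpa using hz)]
  have hen : ‖ζ * e0‖ = 1 := by rw [norm_mul, hζ, he0n, one_mul]
  have s1 := shear_ne_zero hen hm8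
  have s2 := shear_ne_zero hen hm8'
  have unit : ∀ v : ℂ, v ≠ 0 → ‖v / ‖v‖‖ = 1 := fun v hv => by
    rw [norm_div, Complex.norm_real, norm_norm, div_self (by simpa using hv)]
  have dist : ∀ m : ℝ, shear m (ζ * e0) ≠ 0 →
      ‖shear m (ζ * e0) / ‖shear m (ζ * e0)‖ - ζ * e0‖ ≤ 2 * |m| := fun m hm => by
    refine (norm_normalize_sub_le hen hm).trans ?_
    have : shear m (ζ * e0) - ζ * e0 = -((m * (ζ * e0).im : ℝ) : ℂ) := by
      simp only [shear]; push_cast; ring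
    rw [this, norm_neg, Complex.norm_real, Real.norm_eq_abs, abs_mul]
    have := Complex.abs_im_le_norm (ζ * e0)
    rw [hen] at this
    nlinarith [abs_nonneg m]
  rw [correctedLog_shear_sub ψ lam m ζ hz s1, correctedLog_shear_sub ψ lam (-m) ζ hz s2]
  rw [← he0]
  have g1 := abs_log_sq_norm_shear_le hen hm8
  have g2 := abs_log_sq_norm_shear_le hen hm8'
  have g3 := abs_log_sq_norm_shear_add_sub_le hen hm8
  have d1 := (hL _ _ (unit _ s1) hen).trans (mul_le_mul_of_nonneg_left (dist m s1) hK.le)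
  have d2 := (hL _ _ (unit _ s2) hen).trans (mul_le_mul_of_nonneg_left (dist (-m) s2) hK.le)
  have b0 := hb _ he0n
  have b1 := hb _ (unit _ s1)
  have b2 := hb _ (unit _ s2)
  have hc0 := hc e0
  have hre : ((ζ * e0) ^ 2).re / 2 - ((ζ * e0) ^ 4).re / 4 =
      1 / 4 - ((ζ * e0).im ^ 2 - 2 * (ζ * e0).re ^ 2 * (ζ * e0).im ^ 2) := by
    have h1 : (ζ * e0).re ^ 2 + (ζ * e0).im ^ 2 = 1 := by rw [← sq_norm_eq, hen]; norm_num
    rw [show (ζ * e0) ^ 4 = (ζ * e0) ^ 2 * (ζ * e0) ^ 2 by ring, Complex.mul_re]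
    rw [show (ζ * e0) ^ 2 = (ζ * e0) * (ζ * e0) by ring, Complex.mul_re (ζ * e0) (ζ * e0),
      Complex.mul_im (ζ * e0) (ζ * e0)]
    have h3 : (ζ * e0).re ^ 2 = 1 - (ζ * e0).im ^ 2 := by linarith
    generalize (ζ * e0).re = X at *
    generalize (ζ * e0).im = Y at *
    linear_combination (1 / 2 - 1 / 4 * (X ^ 2 + Y ^ 2 + 1)) * h3
  rw [hre] at hc0
  rw [abs_neg, abs_of_pos hm0] at d2 g2
  rw [abs_of_pos hm0] at d1 g1
  set L1 := Real.log (‖shear m (ζ * e0)‖ ^ 2)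
  set L2 := Real.log (‖shear (-m) (ζ * e0)‖ ^ 2)
  set P1 := ψ (shear m (ζ * e0) / ‖shear m (ζ * e0)‖)
  set P2 := ψ (shear (-m) (ζ * e0) / ‖shear (-m) (ζ * e0)‖)
  set P0 := ψ e0
  set Q := ψ (ζ * e0)
  have hmS : 6 * m = 6 / S * lam := by rw [hm]; ring
  have hl2 : lam ^ 2 ≤ lam := by nlinarith
  have first : ∀ L P : ℝ, |L| ≤ 6 * m → |P| ≤ K → |L + lam ^ 2 * (P - P0)| ≤
      (1 + 6 / S + 2 * K + 51 / S ^ 4 + 4 * K / S) * lam := by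
    intro L P hL hP
    have : |lam ^ 2 * (P - P0)| ≤ lam ^ 2 * (2 * K) := by
      rw [abs_mul, abs_of_nonneg (sq_nonneg lam)]
      exact mul_le_mul_of_nonneg_left ((abs_sub _ _).trans (by linarith)) (sq_nonneg _)
    have h5 : lam ^ 2 * (2 * K) ≤ lam * (2 * K) := mul_le_mul_of_nonneg_right hl2 (by linarith)
    have h6 : 0 ≤ (1 + 51 / S ^ 4 + 4 * K / S) * lam := by positivity
    refine (abs_add_le _ _).trans ?_
    rw [hmS] at hL
    linarith
  refine ⟨first _ _ g1 b1, first _ _ g2 b2, ?_⟩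
  have key : L1 + lam ^ 2 * (P1 - P0) + (L2 + lam ^ 2 * (P2 - P0)) -
      2 * (1 / (4 * S ^ 2)) * lam ^ 2 =
      (L1 + L2 - m ^ 2 * (2 * (ζ * e0).im ^ 2 - 4 * (ζ * e0).re ^ 2 * (ζ * e0).im ^ 2)) +
        (lam ^ 2 * (P1 - Q) + lam ^ 2 * (P2 - Q)) := by
    have : P0 = Q - (1 / 4 - ((ζ * e0).im ^ 2 - 2 * (ζ * e0).re ^ 2 * (ζ * e0).im ^ 2)) / S ^ 2 := by
      linarith
    rw [this, hm]
    field_simp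
    ring
  rw [key]
  have t1 : |lam ^ 2 * (P1 - Q)| ≤ lam ^ 2 * (K * (2 * m)) := by
    rw [abs_mul, abs_of_nonneg (sq_nonneg lam)]
    exact mul_le_mul_of_nonneg_left d1 (sq_nonneg _)
  have t2 : |lam ^ 2 * (P2 - Q)| ≤ lam ^ 2 * (K * (2 * m)) := by
    rw [abs_mul, abs_of_nonneg (sq_nonneg lam)]
    exact mul_le_mul_of_nonneg_left d2 (sq_nonneg _)
  have t3 : lam ^ 2 * (K * (2 * m)) = 2 * K / S * lam ^ 3 := by rw [hm]; ring
  have t4 : 51 * m ^ 4 ≤ 51 / S ^ 4 * lam ^ 3 := by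
    have : lam ^ 4 ≤ lam ^ 3 := pow_le_pow_of_le_one hlam.le hlam1' (by norm_num)
    rw [hm, show 51 * (lam / S) ^ 4 = 51 / S ^ 4 * lam ^ 4 by ring]
    exact mul_le_mul_of_nonneg_left this c2
  have t5 : 0 ≤ (1 + 6 / S + 2 * K) * lam ^ 3 := by positivity
  have t6 := abs_add_le (lam ^ 2 * (P1 - Q)) (lam ^ 2 * (P2 - Q))
  refine (abs_add_le _ _).trans ?_
  rw [t3] at t1 t2
  have t7 : 4 * K / S * lam ^ 3 = 2 * (2 * K / S * lam ^ 3) := by ring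
  linarith

lemma exp_add_exp_le {K γ lam p x y : ℝ} (hlam : 0 < lam) (hK : K * lam ≤ 1) (hp : |p| ≤ 1)
    (hx : |x| ≤ K * lam) (hy : |y| ≤ K * lam) (hxy : |x + y - 2 * γ * lam ^ 2| ≤ K * lam ^ 3)
    (hK1 : 1 ≤ K) :
    Real.exp (p * x) + Real.exp (p * y) ≤
      2 * Real.exp ((p * γ + |p| * K ^ 2 * lam + p ^ 2 * K ^ 2) * lam ^ 2) := by
  have quad : ∀ t : ℝ, |t| ≤ K * lam →
      Real.exp (p * t) ≤ 1 + p * t + p ^ 2 * (K ^ 2 * lam ^ 2) := by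
    intro t ht
    have h1 : |p * t| ≤ 1 := by
      rw [abs_mul]
      exact mul_le_one₀ hp (abs_nonneg _) (ht.trans hK)
    have h2 := (abs_le.1 (Real.abs_exp_sub_one_sub_id_le h1)).2
    have h3 : t ^ 2 ≤ K ^ 2 * lam ^ 2 := by
      rw [← sq_abs, ← mul_pow]; exact pow_le_pow_left₀ (abs_nonneg _) ht 2
    have h4 := mul_le_mul_of_nonneg_left h3 (sq_nonneg p)
    rw [mul_pow] at h2
    linarith
  have h5 : p * (x + y - 2 * γ * lam ^ 2) ≤ |p| * (K * lam ^ 3) :=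
    (le_abs_self _).trans (by rw [abs_mul]; exact mul_le_mul_of_nonneg_left hxy (abs_nonneg p))
  have h6 : |p| * (K * lam ^ 3) ≤ |p| * (K ^ 2 * lam ^ 3) := by
    have : K ≤ K ^ 2 := by nlinarith
    gcongr
  have h7 := Real.add_one_le_exp ((p * γ + |p| * K ^ 2 * lam + p ^ 2 * K ^ 2) * lam ^ 2)
  have h8 : 0 ≤ |p| * (K ^ 2 * lam ^ 3) := by positivity
  have h9 : (p * γ + |p| * K ^ 2 * lam + p ^ 2 * K ^ 2) * lam ^ 2 =
    p * γ * lam ^ 2 + |p| * (K ^ 2 * lam ^ 3) + p ^ 2 * (K ^ 2 * lam ^ 2) := by ring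
  linarith [quad x hx, quad y hy]

lemma transferB_cons (lam E : ℝ) (N : ℕ) (b : Bool) (σ : Fin N → Bool) :
    transferB lam E (N + 1) (Fin.cons b σ) = transferB lam E N σ * gE lam E (bval b) := by
  simp [transferB, transfer, List.ofFn_succ]

lemma sum_cube_succ {N : ℕ} (f : (Fin (N + 1) → Bool) → ℝ) :
    ∑ σ, f σ = ∑ σ : Fin N → Bool, (f (Fin.cons true σ) + f (Fin.cons false σ)) := by
  rw [← (Fin.consEquiv fun _ : Fin (N + 1) => Bool).sum_comp, Fintype.sum_prod_type,
    Fintype.sum_bool, ← Finset.sum_add_distrib]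
  rfl

lemma det_transferB (lam E : ℝ) (N : ℕ) (σ : Fin N → Bool) : (transferB lam E N σ).det = 1 := by
  induction N with
  | zero => simp [transferB, transfer]
  | succ N ih =>
    rw [← Fin.cons_self_tail σ, transferB_cons, Matrix.det_mul, ih]
    simp [gE, Matrix.det_fin_two]

lemma mulVec_ne_zero_of_det {A : Matrix (Fin 2) (Fin 2) ℝ} (hA : A.det = 1) {u : Fin 2 → ℝ}
    (hu : u ≠ 0) : A.mulVec u ≠ 0 := fun h =>
  hu (Matrix.eq_zero_of_mulVec_eq_zero (by rw [hA]; exact one_ne_zero) h)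

lemma sum_transferB_mulVec_le {lam E G : ℝ} (hG : 0 ≤ G) {F : (Fin 2 → ℝ) → ℝ}
    (hF : ∀ u ≠ 0, F ((gE lam E 1).mulVec u) + F ((gE lam E (-1)).mulVec u) ≤ G * F u)
    (N : ℕ) {u : Fin 2 → ℝ} (hu : u ≠ 0) :
    ∑ σ, F ((transferB lam E N σ).mulVec u) ≤ G ^ N * F u := by
  induction N generalizing u with
  | zero => simp [transferB, transfer]
  | succ N ih =>
    have hd : ∀ x, (gE lam E x).det = 1 := fun x => by simp [gE, Matrix.det_fin_two]
    simp only [sum_cube_succ, transferB_cons, ← Matrix.mulVec_mulVec, Finset.sum_add_distrib]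
    have h1 := ih (mulVec_ne_zero_of_det (hd 1) hu)
    have h2 := ih (mulVec_ne_zero_of_det (hd (-1)) hu)
    have h3 := mul_le_mul_of_nonneg_left (hF u hu) (pow_nonneg hG N)
    simp only [bval, if_true, Bool.false_eq_true, if_false]
    rw [pow_succ, mul_assoc]
    linarith

lemma sum_transferB_transpose_mulVec_le {lam E G : ℝ} (hG : 0 ≤ G) {F : (Fin 2 → ℝ) → ℝ}
    (hF : ∀ u ≠ 0, F ((gE lam E 1).transpose.mulVec u) + F ((gE lam E (-1)).transpose.mulVec u) ≤
      G * F u)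
    (N : ℕ) {u : Fin 2 → ℝ} (hu : u ≠ 0) :
    ∑ σ, F ((transferB lam E N σ).transpose.mulVec u) ≤ G ^ N * F u := by
  induction N with
  | zero => simp [transferB, transfer]
  | succ N ih =>
    simp only [sum_cube_succ, transferB_cons, Matrix.transpose_mul, ← Matrix.mulVec_mulVec]
    rw [pow_succ', mul_assoc]
    refine le_trans ?_ (mul_le_mul_of_nonneg_left ih hG)
    rw [Finset.mul_sum]
    refine Finset.sum_le_sum fun σ _ => ?_
    have hd : (transferB lam E N σ).transpose.det = 1 := by
      rw [Matrix.det_transpose, det_transferB]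
    simpa [bval] using hF _ (mulVec_ne_zero_of_det hd hu)

/-- Reflection in the first coordinate axis. -/
def reflect (u : Fin 2 → ℝ) : Fin 2 → ℝ := ![u 0, -u 1]

lemma reflect_gE_transpose (lam E x : ℝ) (u : Fin 2 → ℝ) :
    reflect ((gE lam E x).transpose.mulVec u) = (gE lam E x).mulVec (reflect u) := by
  ext i
  fin_cases i <;> simp [reflect, gE, Matrix.mulVec, dotProduct, Fin.sum_univ_two]

lemma normSq2_reflect (u : Fin 2 → ℝ) : normSq2 (reflect u) = normSq2 u := by
  simp [reflect, normSq2]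

lemma normSq2_pos {u : Fin 2 → ℝ} (hu : u ≠ 0) : 0 < normSq2 u := by
  by_contra h
  refine hu (funext fun i => ?_)
  unfold normSq2 at h
  fin_cases i <;> simp <;> nlinarith [sq_nonneg (u 0), sq_nonneg (u 1)]

lemma reflect_ne_zero {u : Fin 2 → ℝ} (hu : u ≠ 0) : reflect u ≠ 0 := by
  intro h
  have := normSq2_pos hu
  rw [← normSq2_reflect, h] at this
  simp [normSq2] at this

/-- Sharp exponential moment bounds for the log-norm of the image of a unit vector under the
transfer matrix and under its transpose. -/
lemma exists_moment_bound {E : ℝ} (hE0 : E ≠ 0) (hE2 : |E| < 2) :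
    ∃ K lam1 : ℝ, 1 ≤ K ∧ 0 < lam1 ∧ ∀ lam p : ℝ, 0 < lam → lam < lam1 → |p| ≤ 1 →
      ∀ (N : ℕ) (u : Fin 2 → ℝ), normSq2 u = 1 →
        ∑ σ, Real.exp (p * Real.log (normSq2 ((transferB lam E N σ).mulVec u))) ≤
          2 ^ N * (K * Real.exp ((p / (4 - E ^ 2) + |p| * K * lam + p ^ 2 * K) * (lam ^ 2 * N))) ∧
        ∑ σ, Real.exp (p * Real.log (normSq2 ((transferB lam E N σ).transpose.mulVec u))) ≤
          2 ^ N * (K * Real.exp ((p / (4 - E ^ 2) + |p| * K * lam + p ^ 2 * K) * (lam ^ 2 * N))) := by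
  have hEsq : 0 < 1 - E ^ 2 / 4 := by
    rw [← sq_abs]; nlinarith [abs_nonneg E]
  set ζ : ℂ := ⟨E / 2, Real.sqrt (1 - E ^ 2 / 4)⟩ with hζdef
  have hS : 0 < ζ.im := Real.sqrt_pos.2 hEsq
  have hS2 : ζ.im ^ 2 = 1 - E ^ 2 / 4 := Real.sq_sqrt hEsq.le
  have hre : ζ.re = E / 2 := rfl
  have hEζ : E = 2 * ζ.re := by rw [hre]; ring
  have hζ : ‖ζ‖ = 1 := by
    have : ‖ζ‖ ^ 2 = 1 := by rw [sq_norm_eq, hS2, hre]; ring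
    exact (pow_eq_one_iff_of_nonneg (norm_nonneg _) two_ne_zero).1 this
  have hsq_im : (ζ ^ 2).im ≠ 0 := by
    rw [pow_two, Complex.mul_im, hre]
    have : E / 2 * ζ.im + ζ.im * (E / 2) = E * ζ.im := by ring
    rw [this]; exact mul_ne_zero hE0 hS.ne'
  have h2 : ζ ^ 2 ≠ 1 := fun h => hsq_im (by rw [h]; simp)
  have h4 : ζ ^ 4 ≠ 1 := fun h => by
    have : (ζ ^ 2) ^ 2 = 1 := by rw [← pow_mul]; exact h
    rcases sq_eq_one_iff.1 this with h | h
    · exact h2 h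
    · exact hsq_im (by rw [h]; simp)
  obtain ⟨ψ, K, lam1, hK, hlam1, hlam1', hψ, hest⟩ := exists_correctedLog_estimates hζ hS h2 h4
  set κ : ℝ := 1 - |E| / 2 with hκ
  have hκ0 : 0 < κ := by linarith
  have hκ1 : κ ≤ 1 := by linarith [abs_nonneg E]
  have coord_bounds : ∀ u, κ * normSq2 u ≤ ‖ellipticCoord ζ u‖ ^ 2 ∧
      ‖ellipticCoord ζ u‖ ^ 2 ≤ 2 * normSq2 u := by
    intro u
    rw [sq_norm_ellipticCoord hζ, ← hEζ]
    have h1 : |E * u 0 * u 1| ≤ |E| / 2 * normSq2 u := by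
      have : |u 0 * u 1| ≤ normSq2 u / 2 := by
        unfold normSq2
        exact abs_le.2 ⟨by nlinarith [sq_nonneg (u 0 + u 1)], by nlinarith [sq_nonneg (u 0 - u 1)]⟩
      rw [mul_assoc, abs_mul]
      nlinarith [abs_nonneg E]
    have h0 : 0 ≤ normSq2 u := by unfold normSq2; positivity
    have h2 := abs_le.1 h1
    have e : u 0 ^ 2 - E * u 0 * u 1 + u 1 ^ 2 = normSq2 u - E * u 0 * u 1 := by
      unfold normSq2; ring
    rw [e]
    constructor <;> nlinarith
  have coord_ne : ∀ u, u ≠ 0 → ellipticCoord ζ u ≠ 0 := fun u hu h => by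
    have h1 := (coord_bounds u).1
    rw [h] at h1
    norm_num at h1
    nlinarith [normSq2_pos hu]
  set B : ℝ := 2 - Real.log κ + K with hB
  have hlogκ : Real.log κ ≤ 0 := Real.log_nonpos hκ0.le hκ1
  have hB0 : 0 ≤ B := by linarith
  have compare : ∀ lam : ℝ, 0 < lam → lam < lam1 → ∀ u, u ≠ 0 →
      |correctedLog ψ lam (ellipticCoord ζ u) - Real.log (normSq2 u)| ≤ B := by
    intro lam hl hl' u hu
    have hz := coord_ne u hu
    have hn := normSq2_pos hu
    have hzz : 0 < ‖ellipticCoord ζ u‖ ^ 2 := by positivity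
    have hψ1 := hψ (ellipticCoord ζ u / ‖ellipticCoord ζ u‖) (by
      rw [norm_div, Complex.norm_real, norm_norm, div_self (by simpa using hz)])
    have hl2 : lam ^ 2 ≤ 1 := by nlinarith
    have hp : |lam ^ 2 * ψ (ellipticCoord ζ u / ‖ellipticCoord ζ u‖)| ≤ K := by
      rw [abs_mul, abs_of_nonneg (sq_nonneg lam)]
      nlinarith [abs_nonneg (ψ (ellipticCoord ζ u / ‖ellipticCoord ζ u‖))]
    have l1 := Real.log_le_log (by positivity) (coord_bounds u).1
    have l2 := Real.log_le_log hzz (coord_bounds u).2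
    rw [Real.log_mul hκ0.ne' hn.ne'] at l1
    rw [Real.log_mul two_ne_zero hn.ne'] at l2
    have l3 : Real.log 2 ≤ 1 := by linarith [Real.log_two_lt_d9]
    obtain ⟨p1, p2⟩ := abs_le.1 hp
    unfold correctedLog
    rw [abs_le]
    constructor <;> linarith
  refine ⟨K ^ 2 + Real.exp (2 * B), min lam1 (1 / K), by nlinarith [Real.exp_pos (2 * B)],
    by positivity, ?_⟩
  intro lam p hl hl1 hp N u hu
  have hl' : lam < lam1 := hl1.trans_le (min_le_left _ _)
  have hKl : K * lam ≤ 1 := by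
    have := (hl1.trans_le (min_le_right _ _)).le
    rw [le_div_iff₀ (by linarith)] at this; linarith
  have hu0 : u ≠ 0 := by
    rintro rfl; simp [normSq2] at hu
  set F : (Fin 2 → ℝ) → ℝ := fun v => Real.exp (p * correctedLog ψ lam (ellipticCoord ζ v)) with hFdef
  set γ : ℝ := 1 / (4 * ζ.im ^ 2) with hγ
  have hγE : γ = 1 / (4 - E ^ 2) := by rw [hγ, hS2]; congr 1; ring
  set Γ : ℝ := (p * γ + |p| * K ^ 2 * lam + p ^ 2 * K ^ 2) * lam ^ 2 with hΓ
  have hF : ∀ v ≠ 0, F ((gE lam E 1).mulVec v) + F ((gE lam E (-1)).mulVec v) ≤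
      2 * Real.exp Γ * F v := by
    intro v hv
    obtain ⟨e1, e2, e3⟩ := hest lam hl hl' _ (coord_ne v hv)
    have := exp_add_exp_le (p := p) hl hKl hp e1 e2 e3 hK
    simp only [hFdef]
    rw [hEζ, ellipticCoord_gE hζ hS.ne', ellipticCoord_gE hζ hS.ne', mul_one, mul_neg_one, neg_div]
    have hs := fun a b : ℝ => (show Real.exp (p * a) = Real.exp (p * (a - b)) * Real.exp (p * b) by
      rw [← Real.exp_add]; congr 1; ring)
    rw [hs _ (correctedLog ψ lam (ellipticCoord ζ v)),
      hs (correctedLog ψ lam (shear (-(lam / ζ.im)) (ζ * ellipticCoord ζ v)))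
        (correctedLog ψ lam (ellipticCoord ζ v)), ← add_mul]
    exact mul_le_mul_of_nonneg_right this (Real.exp_pos _).le
  have hG : 0 ≤ 2 * Real.exp Γ := by positivity
  have hpB : ∀ x : ℝ, |x| ≤ B → p * x ≤ B := fun x hx =>
    (le_abs_self _).trans (by rw [abs_mul]; nlinarith [abs_nonneg x, abs_nonneg p])
  have toF : ∀ v ≠ 0, Real.exp (p * Real.log (normSq2 v)) ≤ Real.exp B * F v := by
    intro v hv
    rw [← Real.exp_add, Real.exp_le_exp]
    have := hpB _ ((abs_sub_comm _ _).trans_le (compare lam hl hl' v hv))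
    linarith
  have fromF : ∀ v ≠ 0, normSq2 v = 1 → F v ≤ Real.exp B := by
    intro v hv h1
    rw [Real.exp_le_exp]
    have h := compare lam hl hl' v hv
    rw [h1, Real.log_one, sub_zero] at h
    exact hpB _ h
  have final : Real.exp B * ((2 * Real.exp Γ) ^ N * Real.exp B) ≤
      2 ^ N * ((K ^ 2 + Real.exp (2 * B)) * Real.exp ((p / (4 - E ^ 2) +
        |p| * (K ^ 2 + Real.exp (2 * B)) * lam + p ^ 2 * (K ^ 2 + Real.exp (2 * B))) *
          (lam ^ 2 * N))) := by
    have hx := Real.exp_pos (2 * B)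
    have e1 : Real.exp B * ((2 * Real.exp Γ) ^ N * Real.exp B) =
        2 ^ N * (Real.exp (2 * B) * Real.exp (N * Γ)) := by
      have : Real.exp (2 * B) = Real.exp B * Real.exp B := by rw [← Real.exp_add, ← two_mul]
      rw [mul_pow, ← Real.exp_nat_mul, this]; ring
    have e2 : N * Γ ≤ (p / (4 - E ^ 2) + |p| * (K ^ 2 + Real.exp (2 * B)) * lam +
        p ^ 2 * (K ^ 2 + Real.exp (2 * B))) * (lam ^ 2 * N) := by
      have : N * Γ = (p * γ + |p| * K ^ 2 * lam + p ^ 2 * K ^ 2) * (lam ^ 2 * N) := by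
        rw [hΓ]; ring
      rw [this, hγE, mul_one_div]
      gcongr <;> linarith
    rw [e1]
    gcongr
    nlinarith
  constructor
  · refine le_trans ?_ final
    refine le_trans (Finset.sum_le_sum fun σ _ =>
      toF _ (mulVec_ne_zero_of_det (det_transferB lam E N σ) hu0)) ?_
    rw [← Finset.mul_sum]
    refine mul_le_mul_of_nonneg_left ?_ (Real.exp_pos _).le
    exact (sum_transferB_mulVec_le hG hF N hu0).trans
      (mul_le_mul_of_nonneg_left (fromF u hu0 hu) (pow_nonneg hG N))
  · refine le_trans ?_ final
    refine le_trans (Finset.sum_le_sum (g := fun σ =>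
      Real.exp B * F (reflect ((transferB lam E N σ).transpose.mulVec u))) fun σ _ => ?_) ?_
    · rw [← normSq2_reflect]
      exact toF _ (reflect_ne_zero (mulVec_ne_zero_of_det
        (by rw [Matrix.det_transpose, det_transferB]) hu0))
    rw [← Finset.mul_sum]
    refine mul_le_mul_of_nonneg_left ?_ (Real.exp_pos _).le
    refine (sum_transferB_transpose_mulVec_le (F := fun v => F (reflect v)) hG
      (fun v hv => ?_) N hu0).trans (mul_le_mul_of_nonneg_left
        (fromF _ (reflect_ne_zero hu0) (by rw [normSq2_reflect, hu])) (pow_nonneg hG N))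
    simp only [reflect_gE_transpose]
    exact hF _ (reflect_ne_zero hv)

lemma mes_mono {n : ℕ} {S T : Set (Fin n → Bool)} (h : S ⊆ T) : mes S ≤ mes T := by
  classical
  unfold mes
  gcongr

lemma mes_union_le {n : ℕ} (S T : Set (Fin n → Bool)) : mes (S ∪ T) ≤ mes S + mes T := by
  classical
  unfold mes
  rw [← add_div]
  gcongr
  simp only [Set.mem_union, Finset.filter_or]
  exact_mod_cast Finset.card_union_le _ _

lemma mes_le_one {n : ℕ} (S : Set (Fin n → Bool)) : mes S ≤ 1 := by
  classical
  unfold mes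
  rw [div_le_one (by positivity)]
  have := Finset.card_le_univ (Finset.univ.filter fun ε => ε ∈ S)
  simp only [Fintype.card_fun, Fintype.card_bool, Fintype.card_fin] at this
  exact_mod_cast this

/-- Exponential Chebyshev inequality. -/
lemma mes_le_of_sum_exp_le {n : ℕ} {S : Set (Fin n → Bool)} {f : (Fin n → Bool) → ℝ} {b X : ℝ}
    (hS : ∀ σ ∈ S, b ≤ f σ) (hX : ∑ σ, Real.exp (f σ) ≤ 2 ^ n * X) :
    mes S ≤ X * Real.exp (-b) := by
  classical
  unfold mes
  rw [div_le_iff₀ (by positivity)]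
  have h : ((Finset.univ.filter fun ε => ε ∈ S).card : ℝ) * Real.exp b ≤ 2 ^ n * X := by
    rw [← nsmul_eq_mul, ← Finset.sum_const]
    refine le_trans (Finset.sum_le_sum fun σ hσ => ?_) (le_trans
      (Finset.sum_le_sum_of_subset_of_nonneg (Finset.subset_univ _)
        fun σ _ _ => (Real.exp_pos (f σ)).le) hX)
    exact Real.exp_le_exp.2 (hS σ (by simpa using hσ))
  calc _ = (((Finset.univ.filter fun ε => ε ∈ S).card : ℝ) * Real.exp b) * Real.exp (-b) := by
        rw [mul_assoc, ← Real.exp_add]; simp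
    _ ≤ 2 ^ n * X * Real.exp (-b) := by gcongr
    _ = _ := by ring

/-- Rotation by a right angle. -/
def perp (u : Fin 2 → ℝ) : Fin 2 → ℝ := ![-u 1, u 0]

lemma normSq2_perp (u : Fin 2 → ℝ) : normSq2 (perp u) = normSq2 u := by
  simp [normSq2, perp]; ring

lemma opNorm_sq_le (A : Matrix (Fin 2) (Fin 2) ℝ) {u : Fin 2 → ℝ} (hu : normSq2 u = 1) :
    opNorm A ^ 2 ≤ normSq2 (A.mulVec u) + normSq2 (A.mulVec (perp u)) := by
  have hF : normSq2 (A.mulVec u) + normSq2 (A.mulVec (perp u)) =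
      A 0 0 ^ 2 + A 0 1 ^ 2 + A 1 0 ^ 2 + A 1 1 ^ 2 := by
    simp only [normSq2] at hu
    simp [normSq2, perp, Matrix.mulVec, dotProduct, Fin.sum_univ_two]
    linear_combination (A 0 0 ^ 2 + A 0 1 ^ 2 + A 1 0 ^ 2 + A 1 1 ^ 2) * hu
  rw [hF]
  have h : opNorm A ≤ Real.sqrt (A 0 0 ^ 2 + A 0 1 ^ 2 + A 1 0 ^ 2 + A 1 1 ^ 2) := by
    refine ContinuousLinearMap.opNorm_le_bound _ (Real.sqrt_nonneg _) fun x => ?_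
    rw [EuclideanSpace.norm_eq, EuclideanSpace.norm_eq, ← Real.sqrt_mul (by positivity)]
    refine Real.sqrt_le_sqrt ?_
    simp [Fin.sum_univ_two, Matrix.mulVec, dotProduct]
    nlinarith [sq_nonneg (A 0 0 * x 1 - A 0 1 * x 0), sq_nonneg (A 1 0 * x 1 - A 1 1 * x 0)]
  calc opNorm A ^ 2 ≤ _ := pow_le_pow_left₀ (norm_nonneg _) h 2
    _ = _ := Real.sq_sqrt (by positivity)

lemma le_of_small_entry {A B C D P Q η s : ℝ} (hdet : A * D - B * C = 1)
    (hη : 0 ≤ η) (hη1 : η ≤ 1) (hB : P ≤ A ^ 2 + B ^ 2) (hC : P ≤ A ^ 2 + C ^ 2)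
    (hQ : A ^ 2 + B ^ 2 ≤ Q) (hQ' : C ^ 2 + D ^ 2 ≤ Q)
    (hsQ : s ^ 2 ≤ A ^ 2 + B ^ 2 + (C ^ 2 + D ^ 2)) (hA : |A| < η * s) :
    P ≤ 1 + 4 * (η * Q) := by
  have hQ0 : 0 ≤ Q := by nlinarith [sq_nonneg A, sq_nonneg B]
  have hA2 : A ^ 2 ≤ η ^ 2 * (2 * Q) := by
    rw [← sq_abs]
    have h1 : |A| ^ 2 ≤ (η * s) ^ 2 := pow_le_pow_left₀ (abs_nonneg _) hA.le 2
    rw [mul_pow] at h1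
    exact h1.trans (mul_le_mul_of_nonneg_left (by linarith) (sq_nonneg η))
  have hηQ : 0 ≤ η * Q := by positivity
  have hA2' : A ^ 2 ≤ 2 * (η * Q) := by nlinarith [mul_le_mul_of_nonneg_right hη1 hηQ]
  rcases le_or_gt (P - 2 * (η * Q)) 0 with h | h
  · linarith
  have hBC : P - 2 * (η * Q) ≤ |B * C| := by
    refine abs_le_of_sq_le_sq' ?_ (abs_nonneg _) |>.2
    rw [sq_abs, mul_pow, pow_two (P - 2 * (η * Q))]
    exact mul_le_mul (by linarith) (by linarith) h.le (sq_nonneg _)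
  have hAD : |A * D| ≤ 2 * (η * Q) := by
    refine abs_le_of_sq_le_sq ?_ (by positivity)
    have hD : D ^ 2 ≤ Q := by linarith [sq_nonneg C]
    rw [mul_pow]
    calc A ^ 2 * D ^ 2 ≤ η ^ 2 * (2 * Q) * Q :=
          mul_le_mul hA2 hD (sq_nonneg _) (by positivity)
      _ ≤ (2 * (η * Q)) ^ 2 := by nlinarith [sq_nonneg (η * Q)]
  have : |B * C| ≤ |A * D| + 1 := by
    rw [show B * C = A * D - 1 by linarith]
    exact (abs_sub _ _).trans (by simp)
  linarith

lemma le_of_abs_dot2_lt {M : Matrix (Fin 2) (Fin 2) ℝ} (hM : M.det = 1) {u w : Fin 2 → ℝ}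
    (hu : normSq2 u = 1) (hw : normSq2 w = 1) {P Q η : ℝ} (hη : 0 ≤ η) (hη1 : η ≤ 1)
    (h1 : P ≤ normSq2 (M.mulVec u)) (h2 : P ≤ normSq2 (M.transpose.mulVec w))
    (h3 : normSq2 (M.mulVec u) ≤ Q) (h4 : normSq2 (M.mulVec (perp u)) ≤ Q)
    (h : |dot2 (M.mulVec u) w| < η * opNorm M) : P ≤ 1 + 4 * (η * Q) := by
  have pars : ∀ v, normSq2 v = dot2 v w ^ 2 + dot2 v (perp w) ^ 2 := fun v => by
    simp only [normSq2] at hw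
    simp [normSq2, dot2, perp]
    linear_combination -(v 0 ^ 2 + v 1 ^ 2) * hw
  have parsT : normSq2 (M.transpose.mulVec w) =
      dot2 (M.mulVec u) w ^ 2 + dot2 (M.mulVec (perp u)) w ^ 2 := by
    simp only [normSq2] at hu
    simp [normSq2, dot2, perp, Matrix.mulVec, dotProduct, Fin.sum_univ_two]
    linear_combination -((M 0 0 * w 0 + M 1 0 * w 1) ^ 2 + (M 0 1 * w 0 + M 1 1 * w 1) ^ 2) * hu
  have hop := opNorm_sq_le M hu
  rw [parsT] at h2
  rw [pars] at h1 h3 h4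
  rw [pars, pars (M.mulVec (perp u))] at hop
  refine le_of_small_entry ?_ hη hη1 h1 h2 h3 h4 hop h
  rw [Matrix.det_fin_two] at hM
  simp only [normSq2] at hu hw
  simp [dot2, perp, Matrix.mulVec, dotProduct, Fin.sum_univ_two]
  linear_combination (u 0 ^ 2 + u 1 ^ 2) * (w 0 ^ 2 + w 1 ^ 2) * hM +
    (w 0 ^ 2 + w 1 ^ 2) * hu + hw

lemma one_add_exp_lt {γ t : ℝ} (hγ : 1 / 4 ≤ γ) (ht : 2000 ≤ t) :
    1 + 4 * (Real.exp (-t / 500) * Real.exp ((γ + 1 / 2000) * t)) <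
      Real.exp ((γ - 1 / 2000) * t) := by
  have h1 : Real.exp (-t / 500) * Real.exp ((γ + 1 / 2000) * t) =
      Real.exp (-(t / 1000)) * Real.exp ((γ - 1 / 2000) * t) := by
    rw [← Real.exp_add, ← Real.exp_add]; congr 1; ring
  have h2 : Real.exp (-(t / 1000)) ≤ 1 / 5 := by
    rw [Real.exp_neg, one_div]
    refine inv_anti₀ (by norm_num) ?_
    have := Real.quadratic_le_exp_of_nonneg (x := t / 1000) (by linarith)
    nlinarith
  have h3 := Real.add_one_le_exp ((γ - 1 / 2000) * t)
  have h4 : 9 ≤ (γ - 1 / 2000) * t := by nlinarith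
  rw [h1]
  nlinarith [Real.exp_pos ((γ - 1 / 2000) * t)]

lemma exists_large_deviation_bound {E : ℝ} (hE0 : E ≠ 0) (hE2 : |E| < 2) {ε : ℝ} (hε : 0 < ε) :
    ∃ K c lam1 : ℝ, 0 < K ∧ 0 < c ∧ 0 < lam1 ∧ ∀ lam : ℝ, 0 < lam → lam < lam1 →
      ∀ (N : ℕ) (u : Fin 2 → ℝ), normSq2 u = 1 →
        mes {σ | normSq2 ((transferB lam E N σ).mulVec u) <
          Real.exp ((1 / (4 - E ^ 2) - ε) * (lam ^ 2 * N))} ≤ K * Real.exp (-c * (lam ^ 2 * N)) ∧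
        mes {σ | normSq2 ((transferB lam E N σ).transpose.mulVec u) <
          Real.exp ((1 / (4 - E ^ 2) - ε) * (lam ^ 2 * N))} ≤ K * Real.exp (-c * (lam ^ 2 * N)) ∧
        mes {σ | Real.exp ((1 / (4 - E ^ 2) + ε) * (lam ^ 2 * N)) <
          normSq2 ((transferB lam E N σ).mulVec u)} ≤ K * Real.exp (-c * (lam ^ 2 * N)) := by
  obtain ⟨K, lam1, hK, hlam1, hmom⟩ := exists_moment_bound hE0 hE2
  have hK0 : 0 < K := by linarith
  set q := min 1 (ε / (4 * K)) with hq
  have hq0 : 0 < q := by positivity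
  have hq1 : q ≤ 1 := min_le_left _ _
  have hqK : q * K ≤ ε / 4 := by
    have : q ≤ ε / (4 * K) := min_le_right _ _
    rw [le_div_iff₀ (by positivity)] at this; linarith
  refine ⟨K, q * ε / 2, min lam1 (ε / (4 * K)), hK0, by positivity, by positivity, ?_⟩
  intro lam hl hl1 N u hu
  have hlK : K * lam ≤ ε / 4 := by
    have := (hl1.trans_le (min_le_right _ _)).le
    rw [le_div_iff₀ (by positivity)] at this; linarith
  have hu0 : u ≠ 0 := by rintro rfl; simp [normSq2] at hu
  have hl' := hl1.trans_le (min_le_left _ _)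
  have hqa : |q| = q := abs_of_pos hq0
  obtain ⟨m1, m2⟩ := hmom lam (-q) hl hl' (by rwa [abs_neg, hqa]) N u hu
  obtain ⟨m3, -⟩ := hmom lam q hl hl' (by rwa [hqa]) N u hu
  rw [abs_neg, hqa] at m1 m2
  rw [hqa] at m3
  set γ := 1 / (4 - E ^ 2) with hγ
  set t := lam ^ 2 * (N : ℝ) with ht
  have ht0 : 0 ≤ t := by positivity
  have hdet := det_transferB lam E N
  have hdetT : ∀ σ, (transferB lam E N σ).transpose.det = 1 := fun σ => by
    rw [Matrix.det_transpose, hdet]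
  have err : (q * K * lam + q ^ 2 * K) ≤ q * ε / 2 := by
    nlinarith [mul_le_mul_of_nonneg_left hlK hq0.le, mul_le_mul_of_nonneg_left hqK hq0.le]
  have bound : ∀ p b : ℝ, p / (4 - E ^ 2) * t - b = -(q * ε) * t →
      K * Real.exp ((p / (4 - E ^ 2) + q * K * lam + q ^ 2 * K) * t) * Real.exp (-b) ≤
        K * Real.exp (-(q * ε / 2) * t) := by
    intro p b h
    rw [mul_assoc, ← Real.exp_add]
    gcongr
    nlinarith [mul_le_mul_of_nonneg_right err ht0]
  have hn : (-q) ^ 2 = q ^ 2 := neg_sq q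
  rw [hn] at m1 m2
  have low : ∀ x : ℝ, 0 < x → x < Real.exp ((γ - ε) * t) →
      -q * ((γ - ε) * t) ≤ -q * Real.log x := fun x hx h => by
    have := (Real.log_lt_iff_lt_exp hx).2 h
    nlinarith
  refine ⟨?_, ?_, ?_⟩
  · refine (mes_le_of_sum_exp_le (fun σ hσ => low _ (normSq2_pos
      (mulVec_ne_zero_of_det (hdet σ) hu0)) hσ) m1).trans (bound _ _ ?_)
    rw [hγ]; ring
  · refine (mes_le_of_sum_exp_le (fun σ hσ => low _ (normSq2_pos
      (mulVec_ne_zero_of_det (hdetT σ) hu0)) hσ) m2).trans (bound _ _ ?_)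
    rw [hγ]; ring
  · refine (mes_le_of_sum_exp_le (b := q * ((γ + ε) * t)) (fun σ hσ => ?_) m3).trans
      (bound _ _ ?_)
    · have := (Real.lt_log_iff_exp_lt (normSq2_pos (mulVec_ne_zero_of_det (hdet σ) hu0))).2 hσ
      nlinarith
    · rw [hγ]; ring

/-- For `δ₀ < |E| < 2 - δ₀`, small `λ`, `N ≥ 1`, `η₁ = e^{-λ²N/500}` and all
unit vectors `u, w`:
`mes[ε : |⟨M_N(E;ε)u, w⟩| < η₁ ‖M_N(E;ε)‖] ≤ C η₁^{c₁/2}`. -/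
theorem matrix_element_anticoncentration
    (δ₀ : ℝ) (hδ₀ : 0 < δ₀) (hδ₀' : δ₀ < 1) (E : ℝ)
    (hE : δ₀ < |E|) (hE' : |E| < 2 - δ₀) :
    ∃ c₁ C lam0 : ℝ, 0 < c₁ ∧ 0 < C ∧ 0 < lam0 ∧
      ∀ lam : ℝ, 0 < lam → lam < lam0 →
        ∀ N : ℕ, 1 ≤ N →
          ∀ u w : Fin 2 → ℝ, norm2 u = 1 → norm2 w = 1 →
            mes {σ : Fin N → Bool |
                |dot2 ((transferB lam E N σ).mulVec u) w| <
                  Real.exp (-(lam ^ 2 * N) / 500) * opNorm (transferB lam E N σ)} ≤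
              C * Real.exp (-(lam ^ 2 * N) / 500) ^ (c₁ / 2) := by
  have hE0 : E ≠ 0 := fun h => by
    rw [h, abs_zero] at hE; linarith
  have hE2 : |E| < 2 := by linarith
  obtain ⟨K, c, lam1, hK, hc, hlam1, hdev⟩ :=
    exists_large_deviation_bound hE0 hE2 (ε := 1 / 2000) (by norm_num)
  refine ⟨1000 * c, 4 * K + Real.exp (2000 * c), lam1, by positivity, by positivity, hlam1, ?_⟩
  intro lam hl hl1 N _ u w hu hw
  have unit : ∀ v, norm2 v = 1 → normSq2 v = 1 := fun v hv => by
    unfold norm2 at hv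
    exact Real.sqrt_eq_one.1 hv
  replace hu := unit u hu
  replace hw := unit w hw
  obtain ⟨d1, -, d3⟩ := hdev lam hl hl1 N u hu
  obtain ⟨-, d2, -⟩ := hdev lam hl hl1 N w hw
  obtain ⟨-, -, d4⟩ := hdev lam hl hl1 N (perp u) (by rw [normSq2_perp, hu])
  set t := lam ^ 2 * (N : ℝ) with ht
  have ht0 : 0 ≤ t := by positivity
  have hexp : Real.exp (-t / 500) ^ (1000 * c / 2) = Real.exp (-c * t) := by
    rw [← Real.exp_mul]; congr 1; ring
  rw [hexp]
  rcases le_or_gt 2000 t with h | h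
  · have hγ : 1 / 4 ≤ 1 / (4 - E ^ 2) := by
      have : 0 < 4 - E ^ 2 := by rw [← sq_abs]; nlinarith [abs_nonneg E]
      exact one_div_le_one_div_of_le this (by nlinarith [sq_nonneg E])
    have hbig := one_add_exp_lt hγ h
    refine (mes_mono (T := (_ ∪ _) ∪ (_ ∪ _)) ?_).trans ((mes_union_le _ _).trans
      ((add_le_add ((mes_union_le _ _).trans (add_le_add d1 d2))
        ((mes_union_le _ _).trans (add_le_add d3 d4))).trans ?_))
    · intro σ hσ
      by_contra hnot
      simp only [Set.mem_union, Set.mem_ofPred_eq, not_or, not_lt] at hnot hσ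
      obtain ⟨⟨h1, h2⟩, h3, h4⟩ := hnot
      have := le_of_abs_dot2_lt (det_transferB lam E N σ) hu hw (Real.exp_pos _).le
        (Real.exp_le_one_iff.2 (by linarith)) h1 h2 h3 h4 hσ
      linarith
    · nlinarith [Real.exp_pos (-c * t), Real.exp_pos (2000 * c)]
  · refine (mes_le_one _).trans ?_
    rw [add_mul, ← Real.exp_add]
    have h1 : 1 ≤ Real.exp (2000 * c + -c * t) := Real.one_le_exp (by nlinarith)
    have h2 : 0 ≤ 4 * K * Real.exp (-c * t) := by positivity
    linarith
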